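/- Let b : ℝ → ℝ be measurable with |b(x)| ≤ M for all x, let x₀ ∈ ℝ, T > 0, and let B(y) := ∫_{x₀}^{y} b(s) ds. Let v : ℝ → ℝ be measurable with |v(y)| ≤ K for all y. Then the function y ↦ e^{B(y)−B(x₀)} · (1/√(2πT)) e^{−(y−x₀)²/(2T)} · v(y) is integrable on ℝ, and ∫_ℝ e^{B(y)−B(x₀)} (1/√(2πT)) e^{−(y−x₀)²/(2T)} |v(y)| dy ≤ 2 K e^{M²T/2}. -/

import Mathlib

open MeasureTheory Real

/-- Integrability of the instrumental density `h` (Lemma 2.2 of the paper):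
if `|b| ≤ M` and `|v| ≤ K`, then
`y ↦ e^{B(y)−B(x₀)} (2πT)^{-1/2} e^{−(y−x₀)²/(2T)} v(y)` is integrable and the
corresponding integral with `|v|` is bounded by `2 K e^{M²T/2}`. -/
theorem stmt0 (b v : ℝ → ℝ) (M K : ℝ) (x₀ T : ℝ) (hT : 0 < T)
    (hb : Measurable b) (hbM : ∀ x, |b x| ≤ M)
    (hv : Measurable v) (hvK : ∀ y, |v y| ≤ K)
    (B : ℝ → ℝ) (hB : ∀ y, B y = ∫ s in x₀..y, b s) :
    Integrable (fun y : ℝ =>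
      Real.exp (B y - B x₀) * (1 / Real.sqrt (2 * Real.pi * T)) *
        Real.exp (-(y - x₀) ^ 2 / (2 * T)) * v y) ∧
    (∫ y : ℝ, Real.exp (B y - B x₀) * (1 / Real.sqrt (2 * Real.pi * T)) *
        Real.exp (-(y - x₀) ^ 2 / (2 * T)) * |v y|) ≤
      2 * K * Real.exp (M ^ 2 * T / 2) := by
  have hM : 0 ≤ M := (abs_nonneg _).trans (hbM 0)
  have hK : 0 ≤ K := (abs_nonneg _).trans (hvK 0)
  have hbi : ∀ a c : ℝ, IntervalIntegrable b volume a c := by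
    intro a c
    refine (intervalIntegrable_const (c := M)).mono_fun hb.aestronglyMeasurable ?_
    refine Filter.Eventually.of_forall fun x => ?_
    simpa [abs_of_nonneg hM] using hbM x
  have hBc : Continuous B := by
    have : B = fun y => ∫ s in x₀..y, b s := funext hB
    rw [this]
    exact intervalIntegral.continuous_primitive hbi x₀
  have hBb : ∀ y, B y - B x₀ ≤ M * |y - x₀| := by
    intro y
    have h0 : B x₀ = 0 := by rw [hB]; simp
    rw [h0, sub_zero, hB]
    refine (le_abs_self _).trans ?_
    have := intervalIntegral.norm_integral_le_of_norm_le_const (a := x₀) (b := y) (f := b) (C := M)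
      (fun x _ => by simpa using hbM x)
    simpa using this
  let t : NNReal := ⟨T, hT.le⟩
  have ht : t ≠ 0 := fun h => hT.ne' (congrArg NNReal.toReal h)
  let G : ℝ → ℝ := fun y => K * Real.exp (M ^ 2 * T / 2) *
    (ProbabilityTheory.gaussianPDFReal (x₀ + M * T) t y +
      ProbabilityTheory.gaussianPDFReal (x₀ - M * T) t y)
  have hi1 := ProbabilityTheory.integrable_gaussianPDFReal (x₀ + M * T) t
  have hi2 := ProbabilityTheory.integrable_gaussianPDFReal (x₀ - M * T) t
  have hG : Integrable G := (hi1.add hi2).const_mul _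
  have hGint : ∫ y, G y = 2 * K * Real.exp (M ^ 2 * T / 2) := by
    simp only [G]
    rw [integral_const_mul, integral_add hi1 hi2,
      ProbabilityTheory.integral_gaussianPDFReal_eq_one _ ht,
      ProbabilityTheory.integral_gaussianPDFReal_eq_one _ ht]
    ring
  have key : ∀ c y : ℝ, Real.exp (c * (y - x₀)) * Real.exp (-(y - x₀) ^ 2 / (2 * T)) =
      Real.exp (c ^ 2 * T / 2) * Real.exp (-(y - (x₀ + c * T)) ^ 2 / (2 * T)) := by
    intro c y
    rw [← Real.exp_add, ← Real.exp_add]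
    congr 1
    field_simp
    ring
  have hle : ∀ y, Real.exp (B y - B x₀) * (1 / Real.sqrt (2 * Real.pi * T)) *
        Real.exp (-(y - x₀) ^ 2 / (2 * T)) * |v y| ≤ G y := by
    intro y
    have h1 : Real.exp (B y - B x₀) ≤ Real.exp (M * (y - x₀)) + Real.exp ((-M) * (y - x₀)) := by
      refine (Real.exp_le_exp.2 (hBb y)).trans ?_
      rcases abs_cases (y - x₀) with ⟨h, _⟩ | ⟨h, _⟩ <;> rw [h]
      · linarith [Real.exp_pos ((-M) * (y - x₀))]
      · rw [mul_neg, ← neg_mul]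
        linarith [Real.exp_pos (M * (y - x₀))]
    calc _ ≤ (Real.exp (M * (y - x₀)) + Real.exp ((-M) * (y - x₀))) *
          (1 / Real.sqrt (2 * Real.pi * T)) * Real.exp (-(y - x₀) ^ 2 / (2 * T)) * K := by
          gcongr
          exact hvK y
      _ = (1 / Real.sqrt (2 * Real.pi * T)) * K *
          (Real.exp (M * (y - x₀)) * Real.exp (-(y - x₀) ^ 2 / (2 * T)) +
          Real.exp ((-M) * (y - x₀)) * Real.exp (-(y - x₀) ^ 2 / (2 * T))) := by ring
      _ = G y := by
          rw [key, key]
          have e : x₀ + -M * T = x₀ - M * T := by ring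
          have ht' : (t : ℝ) = T := rfl
          simp only [G, ProbabilityTheory.gaussianPDFReal, ht', e, neg_sq]
          ring
  have hint : Integrable (fun y : ℝ =>
      Real.exp (B y - B x₀) * (1 / Real.sqrt (2 * Real.pi * T)) *
        Real.exp (-(y - x₀) ^ 2 / (2 * T)) * v y) := by
    refine hG.mono' ?_ (Filter.Eventually.of_forall fun y => ?_)
    · have := hBc.measurable
      exact Measurable.aestronglyMeasurable (by fun_prop)
    · refine le_of_eq_of_le ?_ (hle y)
      rw [norm_mul, Real.norm_eq_abs, Real.norm_eq_abs, abs_of_nonneg (by positivity)]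
  refine ⟨hint, ?_⟩
  rw [← hGint]
  exact integral_mono_of_nonneg (Filter.Eventually.of_forall fun y => by positivity) hG
    (Filter.Eventually.of_forall hle)
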